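/- (Two-anchor quadratic maximization identity.) Let x ∈ ℝⁿ, y₁, y₂ ∈ ℝ^m, let A ∈ ℝ^{n×m}, let X ∈ ℝ^{n×n} and Y ∈ ℝ^{m×m} be symmetric positive definite, and let γ > 0 with Aᵀ X⁻¹ A − γ² Y⁻¹ ≺ 0. Then the function v ↦ |x − A v|²_{X⁻¹} − (γ²/2) ( |y₁ − v|²_{Y⁻¹} + |y₂ − v|²_{Y⁻¹} ) attains its maximum over v ∈ ℝ^m, and the maximum equals |x − A (y₁ + y₂)/2|²_{(X − γ⁻² A Y Aᵀ)⁻¹} − (γ²/4) |y₁ − y₂|²_{Y⁻¹}. -/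

import Mathlib

open Matrix

/-- Weighted squared norm `|z|²_M = zᵀ M z`. -/
noncomputable def qf {k : ℕ} (M : Matrix (Fin k) (Fin k) ℝ) (z : Fin k → ℝ) : ℝ :=
  z ⬝ᵥ M *ᵥ z

theorem dotProduct_mulVec_transpose_comm {n m : ℕ} (M : Matrix (Fin n) (Fin m) ℝ)
    (a : Fin n → ℝ) (b : Fin m → ℝ) : b ⬝ᵥ Mᵀ *ᵥ a = a ⬝ᵥ M *ᵥ b := by
  rw [mulVec_transpose, dotProduct_comm, dotProduct_mulVec]

theorem qf_add {k : ℕ} {M : Matrix (Fin k) (Fin k) ℝ} (hM : Mᵀ = M) (a b : Fin k → ℝ) :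
    qf M (a + b) = qf M a + 2 * (a ⬝ᵥ M *ᵥ b) + qf M b := by
  have h : b ⬝ᵥ M *ᵥ a = a ⬝ᵥ M *ᵥ b := by
    simpa only [hM] using dotProduct_mulVec_transpose_comm M a b
  simp only [qf, mulVec_add, add_dotProduct, dotProduct_add, h]
  ring

theorem qf_neg {k : ℕ} (M : Matrix (Fin k) (Fin k) ℝ) (a : Fin k → ℝ) :
    qf M (-a) = qf M a := by
  simp [qf, mulVec_neg]

theorem qf_smul {k : ℕ} (M : Matrix (Fin k) (Fin k) ℝ) (c : ℝ) (a : Fin k → ℝ) :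
    qf M (c • a) = c ^ 2 * qf M a := by
  simp only [qf, mulVec_smul, smul_dotProduct, dotProduct_smul, smul_eq_mul]
  ring

theorem qf_sub {k : ℕ} {M : Matrix (Fin k) (Fin k) ℝ} (hM : Mᵀ = M) (a b : Fin k → ℝ) :
    qf M (a - b) = qf M a - 2 * (a ⬝ᵥ M *ᵥ b) + qf M b := by
  rw [sub_eq_add_neg, qf_add hM, qf_neg, mulVec_neg, dotProduct_neg]
  ring

theorem qf_mulVec {n m : ℕ} (M : Matrix (Fin n) (Fin n) ℝ) (A : Matrix (Fin n) (Fin m) ℝ)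
    (w : Fin m → ℝ) : qf M (A *ᵥ w) = qf (Aᵀ * M * A) w := by
  simp only [qf, ← mulVec_mulVec]
  rw [dotProduct_mulVec_transpose_comm, dotProduct_comm]

/-- The parallelogram law around the midpoint of `y₁` and `y₂`. -/
theorem qf_sub_add_qf_sub {k : ℕ} {M : Matrix (Fin k) (Fin k) ℝ} (hM : Mᵀ = M)
    (y₁ y₂ v : Fin k → ℝ) :
    qf M (y₁ - v) + qf M (y₂ - v) =
      2 * qf M (v - (1 / 2 : ℝ) • (y₁ + y₂)) + 1 / 2 * qf M (y₁ - y₂) := by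
  set w := v - (1 / 2 : ℝ) • (y₁ + y₂) with hw
  have h₁ : y₁ - v = (1 / 2 : ℝ) • (y₁ - y₂) - w := by
    rw [hw]; module
  have h₂ : y₂ - v = -((1 / 2 : ℝ) • (y₁ - y₂) + w) := by
    rw [hw]; module
  rw [h₁, h₂, qf_neg, qf_sub hM, qf_add hM, qf_smul]
  ring

/-- The Woodbury identity for `X - c⁻¹ A Y B`. -/
theorem inv_sub_smul_mul_mul {n m : ℕ} {X : Matrix (Fin n) (Fin n) ℝ}
    {Y : Matrix (Fin m) (Fin m) ℝ} (A : Matrix (Fin n) (Fin m) ℝ) (B : Matrix (Fin m) (Fin n) ℝ)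
    {c : ℝ} (hc : c ≠ 0) (hX : IsUnit X.det) (hY : IsUnit Y.det)
    (hP : IsUnit (c • Y⁻¹ - B * X⁻¹ * A).det) :
    (X - c⁻¹ • (A * Y * B))⁻¹ = X⁻¹ + X⁻¹ * A * (c • Y⁻¹ - B * X⁻¹ * A)⁻¹ * B * X⁻¹ := by
  apply inv_eq_right_inv
  set P := c • Y⁻¹ - B * X⁻¹ * A with hPdef
  have hB : B * X⁻¹ * A = c • Y⁻¹ - P := by rw [hPdef]; abel
  have hcancel : A * Y * (B * X⁻¹ * A) * P⁻¹ * B * X⁻¹ =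
      c • (A * P⁻¹ * B * X⁻¹) - A * Y * B * X⁻¹ := by
    rw [hB]
    simp only [Matrix.mul_sub, Matrix.sub_mul, Matrix.mul_smul, Matrix.smul_mul,
      mul_nonsing_inv_cancel_right _ _ hY, mul_nonsing_inv_cancel_right _ _ hP]
  calc (X - c⁻¹ • (A * Y * B)) * (X⁻¹ + X⁻¹ * A * P⁻¹ * B * X⁻¹)
      = X * X⁻¹ + X * X⁻¹ * A * P⁻¹ * B * X⁻¹ - c⁻¹ • (A * Y * B * X⁻¹)
          - c⁻¹ • (A * Y * (B * X⁻¹ * A) * P⁻¹ * B * X⁻¹) := by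
        simp only [Matrix.mul_add, Matrix.sub_mul, Matrix.smul_mul, Matrix.mul_assoc]
        abel
    _ = 1 := by
        rw [hcancel, mul_nonsing_inv _ hX, Matrix.one_mul, smul_sub, inv_smul_smul₀ hc]
        abel

/-- (Two-anchor quadratic maximization identity.) If `Aᵀ X⁻¹ A − γ² Y⁻¹ ≺ 0`, then
`max_v ( |x − A v|²_{X⁻¹} − (γ²/2)(|y₁ − v|²_{Y⁻¹} + |y₂ − v|²_{Y⁻¹}) )
  = |x − A (y₁+y₂)/2|²_{(X − γ⁻² A Y Aᵀ)⁻¹} − (γ²/4)|y₁ − y₂|²_{Y⁻¹}`. -/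
theorem two_anchor_quadratic_maximization {n m : ℕ}
    (x : Fin n → ℝ) (y₁ y₂ : Fin m → ℝ)
    (A : Matrix (Fin n) (Fin m) ℝ)
    (X : Matrix (Fin n) (Fin n) ℝ) (Y : Matrix (Fin m) (Fin m) ℝ)
    (hX : X.PosDef) (hY : Y.PosDef) (γ : ℝ) (hγ : 0 < γ)
    (hconc : (γ ^ 2 • Y⁻¹ - Aᵀ * X⁻¹ * A).PosDef) :
    IsGreatest
      (Set.range fun v : Fin m → ℝ =>
        qf X⁻¹ (x - A *ᵥ v) - γ ^ 2 / 2 * (qf Y⁻¹ (y₁ - v) + qf Y⁻¹ (y₂ - v)))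
      (qf (X - (γ ^ 2)⁻¹ • (A * Y * Aᵀ))⁻¹ (x - A *ᵥ ((1 / 2 : ℝ) • (y₁ + y₂))) -
        γ ^ 2 / 4 * qf Y⁻¹ (y₁ - y₂)) := by
  have hXi : (X⁻¹)ᵀ = X⁻¹ := by simpa using hX.inv.isHermitian.eq
  have hYi : (Y⁻¹)ᵀ = Y⁻¹ := by simpa using hY.inv.isHermitian.eq
  have hdet : ∀ {k : ℕ} {M : Matrix (Fin k) (Fin k) ℝ}, M.PosDef → IsUnit M.det :=
    fun h => (isUnit_iff_isUnit_det _).mp h.isUnit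
  rw [inv_sub_smul_mul_mul A Aᵀ (pow_ne_zero 2 hγ.ne') (hdet hX) (hdet hY) (hdet hconc)]
  set P := γ ^ 2 • Y⁻¹ - Aᵀ * X⁻¹ * A with hPdef
  have hPt : Pᵀ = P := by simpa using hconc.isHermitian.eq
  set yMid := (1 / 2 : ℝ) • (y₁ + y₂) with hyMid
  set z := x - A *ᵥ yMid with hz
  set u := P⁻¹ *ᵥ (Aᵀ *ᵥ (X⁻¹ *ᵥ z)) with hu
  have hPu : P *ᵥ u = Aᵀ *ᵥ (X⁻¹ *ᵥ z) := by
    rw [hu, mulVec_mulVec, mul_nonsing_inv _ (hdet hconc), one_mulVec]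
  have hcross : ∀ w, z ⬝ᵥ X⁻¹ *ᵥ (A *ᵥ w) = w ⬝ᵥ P *ᵥ u := fun w => by
    rw [hPu, dotProduct_mulVec_transpose_comm, dotProduct_comm (X⁻¹ *ᵥ z),
      ← dotProduct_mulVec_transpose_comm X⁻¹ (A *ᵥ w) z, hXi]
  have hqP : ∀ w, qf P w = γ ^ 2 * qf Y⁻¹ w - qf X⁻¹ (A *ᵥ w) := fun w => by
    rw [qf_mulVec, hPdef]
    simp only [qf, sub_mulVec, dotProduct_sub, smul_mulVec, dotProduct_smul, smul_eq_mul]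
  have hval : qf (X⁻¹ + X⁻¹ * A * P⁻¹ * Aᵀ * X⁻¹) z = qf X⁻¹ z + qf P u := by
    have h : qf P u = z ⬝ᵥ X⁻¹ *ᵥ (A *ᵥ u) := (hcross u).symm
    rw [h, hu]
    simp only [qf, add_mulVec, dotProduct_add, mulVec_mulVec, Matrix.mul_assoc]
  have hobj : ∀ v, qf X⁻¹ (x - A *ᵥ v) - γ ^ 2 / 2 * (qf Y⁻¹ (y₁ - v) + qf Y⁻¹ (y₂ - v)) =
      qf (X⁻¹ + X⁻¹ * A * P⁻¹ * Aᵀ * X⁻¹) z - γ ^ 2 / 4 * qf Y⁻¹ (y₁ - y₂)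
        - qf P (v - yMid + u) := fun v => by
    have hx : x - A *ᵥ v = z - A *ᵥ (v - yMid) := by
      rw [hz, mulVec_sub]; abel
    rw [hx, qf_sub_add_qf_sub hYi, qf_sub hXi, hcross, hval, qf_add hPt, hqP (v - yMid)]
    ring
  refine ⟨⟨yMid - u, ?_⟩, ?_⟩
  · have h0 : yMid - u - yMid + u = 0 := by abel
    simp only [hobj, h0]
    simp [qf]
  · rintro _ ⟨v, rfl⟩
    have hnonneg : 0 ≤ qf P (v - yMid + u) := by
      simpa [qf] using hconc.posSemidef.dotProduct_mulVec_nonneg (v - yMid + u)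
    simp only [hobj]
    linarith
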